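/- (Rescaled Poincaré inequality.) Let 1 ≤ p < ∞ and let γ : ℝ → ℝ be continuous, 1-periodic, with values in (−1, 0). There exists a constant C > 0, depending only on p and γ, such that for every positive integer N, with ε = 1/N and R^ε = {(x₁, x₂) ∈ ℝ² : 0 < x₁ < 1, ε γ(x₁/ε) < x₂ < 0}, and for every Lipschitz function φ : ℝ² → ℝ vanishing at every point (x₁, x₂) with x₂ ≤ ε γ(x₁/ε), one has ∫_{R^ε} |φ(x)|^p dx ≤ C ε^p ∫_{R^ε} ‖∇φ(x)‖^p dx. -/

import Mathlib

open MeasureTheory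

/-- The Euclidean norm of the gradient of `φ : ℝ² → ℝ` (via `fderiv`, which equals
the true differential a.e. for Lipschitz functions by Rademacher's theorem). -/
noncomputable def gradNorm (φ : ℝ × ℝ → ℝ) (x : ℝ × ℝ) : ℝ :=
  Real.sqrt ((fderiv ℝ φ x (1, 0)) ^ 2 + (fderiv ℝ φ x (0, 1)) ^ 2)

/-- One-dimensional Poincaré inequality on an interval of length at most `ε`, for a Lipschitz
function vanishing at the left endpoint. -/
theorem LipschitzWith.setIntegral_rpow_le_of_eq_zero {p : ℝ} (hp : 1 ≤ p) {K : NNReal}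
    {g : ℝ → ℝ} (hg : LipschitzWith K g) {a b ε : ℝ} (hab : a < b) (hε : b - a ≤ ε)
    (ha : g a = 0) :
    ∫ t in Set.Ioo a b, |g t| ^ p ≤ ε ^ p * ∫ t in Set.Ioo a b, |deriv g t| ^ p := by
  have hp0 : 0 ≤ p := by linarith
  have hL : 0 < b - a := by linarith
  have hbound : ∀ t, |deriv g t| ≤ K := fun t ↦ norm_deriv_le_of_lipschitz hg
  have hmeas : Measurable fun t ↦ |deriv g t| := (measurable_deriv g).abs
  have hfi : IntegrableOn (fun t ↦ |deriv g t|) (Set.Ioo a b) :=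
    Measure.integrableOn_of_bounded (M := K) (by simp) hmeas.aestronglyMeasurable
      (Filter.Eventually.of_forall fun t ↦ by simpa using hbound t)
  have hgi : IntegrableOn (fun t ↦ |deriv g t| ^ p) (Set.Ioo a b) :=
    Measure.integrableOn_of_bounded (M := (K : ℝ) ^ p) (by simp)
      (hmeas.pow_const p).aestronglyMeasurable
      (Filter.Eventually.of_forall fun t ↦ by
        rw [Real.norm_of_nonneg (by positivity)]
        exact Real.rpow_le_rpow (abs_nonneg _) (hbound t) hp0)
  set I := ∫ t in Set.Ioo a b, |deriv g t| with hI
  set J := ∫ t in Set.Ioo a b, |deriv g t| ^ p with hJ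
  have hI0 : 0 ≤ I := integral_nonneg fun _ ↦ abs_nonneg _
  have hJ0 : 0 ≤ J := integral_nonneg fun _ ↦ by positivity
  have hvol : volume.real (Set.Ioo a b) = b - a := by
    rw [Real.volume_real_Ioo_of_le hab.le]
  have jensen : (I / (b - a)) ^ p ≤ J / (b - a) := by
    have h := (convexOn_rpow hp).map_set_average_le (μ := volume) (t := Set.Ioo a b)
      (f := fun t ↦ |deriv g t|)
      (Real.continuous_rpow_const hp0).continuousOn isClosed_Ici
      (by simp [hab]) (by simp) (Filter.Eventually.of_forall fun t ↦ Set.mem_Ici.mpr (abs_nonneg _)) hfi hgi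
    rw [setAverage_eq, setAverage_eq, hvol] at h
    simpa [div_eq_inv_mul] using h
  have hsup : ∀ t ∈ Set.Ioo a b, |g t| ≤ I := by
    intro t ht
    have hac : AbsolutelyContinuousOnInterval g a t :=
      hg.lipschitzOnWith.absolutelyContinuousOnInterval
    have h := hac.integral_deriv_eq_sub
    rw [ha, sub_zero] at h
    rw [← h, intervalIntegral.integral_of_le ht.1.le]
    refine (abs_integral_le_integral_abs).trans ?_
    exact setIntegral_mono_set hfi (Filter.Eventually.of_forall fun _ ↦ abs_nonneg _)
      (Set.Ioc_subset_Ioo_right ht.2).eventuallyLE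
  calc ∫ t in Set.Ioo a b, |g t| ^ p ≤ ∫ t in Set.Ioo a b, I ^ p := by
        refine integral_mono_of_nonneg (Filter.Eventually.of_forall fun _ ↦ by positivity)
          (by simp) ?_
        filter_upwards [ae_restrict_mem measurableSet_Ioo] with t ht
        exact Real.rpow_le_rpow (abs_nonneg _) (hsup t ht) hp0
    _ = (b - a) * I ^ p := by rw [setIntegral_const, hvol, smul_eq_mul]
    _ = (b - a) * ((b - a) ^ p * (I / (b - a)) ^ p) := by
        rw [← Real.mul_rpow hL.le (by positivity), mul_div_cancel₀ _ hL.ne']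
    _ ≤ (b - a) * ((b - a) ^ p * (J / (b - a))) := by gcongr
    _ = (b - a) ^ p * J := by field_simp
    _ ≤ ε ^ p * J := by gcongr

theorem measurable_gradNorm (φ : ℝ × ℝ → ℝ) : Measurable (gradNorm φ) :=
  (((measurable_fderiv_apply_const ℝ φ (1, 0)).pow_const 2).add
    ((measurable_fderiv_apply_const ℝ φ (0, 1)).pow_const 2)).sqrt

theorem gradNorm_nonneg (φ : ℝ × ℝ → ℝ) (x : ℝ × ℝ) : 0 ≤ gradNorm φ x := Real.sqrt_nonneg _

theorem LipschitzWith.gradNorm_le {K : NNReal} {φ : ℝ × ℝ → ℝ} (hφ : LipschitzWith K φ)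
    (x : ℝ × ℝ) : gradNorm φ x ≤ Real.sqrt (K ^ 2 + K ^ 2) := by
  have h : ∀ v : ℝ × ℝ, ‖v‖ = 1 → (fderiv ℝ φ x v) ^ 2 ≤ (K : ℝ) ^ 2 := fun v hv ↦ by
    refine sq_le_sq' (abs_le.mp ?_).1 (abs_le.mp ?_).2 <;>
    · simpa [hv] using (fderiv ℝ φ x).le_of_opNorm_le (norm_fderiv_le_of_lipschitz ℝ hφ) v
  exact Real.sqrt_le_sqrt
    (add_le_add (h _ (by simp [Prod.norm_def])) (h _ (by simp [Prod.norm_def])))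

theorem DifferentiableAt.abs_deriv_slice_le_gradNorm {φ : ℝ × ℝ → ℝ} {s t : ℝ}
    (h : DifferentiableAt ℝ φ (s, t)) : |deriv (fun u ↦ φ (s, u)) t| ≤ gradNorm φ (s, t) := by
  have hd : HasDerivAt (fun u ↦ φ (s, u)) (fderiv ℝ φ (s, t) (0, 1)) t :=
    h.hasFDerivAt.comp_hasDerivAt t ((hasDerivAt_const t s).prodMk (hasDerivAt_id t))
  rw [hd.deriv]
  exact Real.abs_le_sqrt (le_add_of_nonneg_left (sq_nonneg _))

/-- Poincaré inequality on the region `{s ∈ A, a s < t < b s}` between two graphs at distance at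
most `ε`, for a Lipschitz function vanishing on the lower graph. -/
theorem LipschitzWith.setIntegral_rpow_le_gradNorm {p : ℝ} (hp : 1 ≤ p) {K : NNReal}
    {φ : ℝ × ℝ → ℝ} (hφ : LipschitzWith K φ) {A : Set ℝ} (hA : MeasurableSet A)
    (hA' : volume A ≠ ⊤) {a b : ℝ → ℝ} (ha : Measurable a) (hb : Measurable b) {ε : ℝ}
    (hab : ∀ s, a s < b s) (hε : ∀ s, b s - a s ≤ ε) (hzero : ∀ s, φ (s, a s) = 0) :
    ∫ x in {x : ℝ × ℝ | x.1 ∈ A ∧ a x.1 < x.2 ∧ x.2 < b x.1}, |φ x| ^ p ≤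
      ε ^ p * ∫ x in {x : ℝ × ℝ | x.1 ∈ A ∧ a x.1 < x.2 ∧ x.2 < b x.1}, gradNorm φ x ^ p := by
  have hp0 : 0 ≤ p := by linarith
  have hε0 : 0 ≤ ε := (sub_pos.mpr (hab 0)).le.trans (hε 0)
  set R := {x : ℝ × ℝ | x.1 ∈ A ∧ a x.1 < x.2 ∧ x.2 < b x.1} with hR
  have hRm : MeasurableSet R := (measurable_fst hA).inter
    ((measurableSet_lt (ha.comp measurable_fst) measurable_snd).inter
      (measurableSet_lt measurable_snd (hb.comp measurable_fst)))
  have hslice : ∀ (f : ℝ × ℝ → ℝ) (s : ℝ), ∫ t, R.indicator f (s, t) =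
      A.indicator (fun s ↦ ∫ t in Set.Ioo (a s) (b s), f (s, t)) s := by
    intro f s
    by_cases hs : s ∈ A
    · rw [Set.indicator_of_mem hs, ← integral_indicator measurableSet_Ioo]
      congr 1 with t
      simp [Set.indicator, hR, hs]
    · simp [Set.indicator, hR, hs]
  have hRfin : volume R ≠ ⊤ := by
    have hsec : ∀ s, volume (Prod.mk s ⁻¹' R) ≤ A.indicator (fun _ ↦ ENNReal.ofReal ε) s := by
      intro s
      by_cases hs : s ∈ A
      · rw [Set.indicator_of_mem hs]
        refine (measure_mono (t := Set.Ioo (a s) (b s)) fun t ht ↦ ht.2).trans ?_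
        rw [Real.volume_Ioo]
        exact ENNReal.ofReal_le_ofReal (hε s)
      · simp [hR, hs]
    rw [Measure.volume_eq_prod, Measure.prod_apply hRm]
    refine ((lintegral_mono hsec).trans_lt ?_).ne
    rw [lintegral_indicator_const hA]
    exact ENNReal.mul_lt_top ENNReal.ofReal_lt_top hA'.lt_top
  have hvert : ∀ s, LipschitzWith K fun t ↦ φ (s, t) := fun s ↦ by
    simpa [Function.comp_def] using hφ.comp (LipschitzWith.prodMk_left s)
  have hφbound : ∀ x ∈ R, |φ x| ≤ K * ε := by
    rintro ⟨s, t⟩ ⟨-, h1, h2⟩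
    have h := (hvert s).dist_le_mul t (a s)
    rw [hzero, Real.dist_eq, Real.dist_eq, sub_zero, abs_of_pos (sub_pos.mpr h1)] at h
    refine h.trans ?_
    gcongr
    have := hε s
    dsimp only at h2
    linarith
  have hfi : Integrable (R.indicator fun x ↦ |φ x| ^ p) (volume.prod volume) := by
    refine IntegrableOn.integrable_indicator ?_ hRm
    refine Measure.integrableOn_of_bounded (M := (K * ε) ^ p) hRfin
      (hφ.continuous.measurable.abs.pow_const p).aestronglyMeasurable ?_
    filter_upwards [ae_restrict_mem hRm] with x hx
    rw [Real.norm_of_nonneg (by positivity)]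
    exact Real.rpow_le_rpow (abs_nonneg _) (hφbound x hx) hp0
  have hgi : Integrable (R.indicator fun x ↦ gradNorm φ x ^ p) (volume.prod volume) := by
    refine IntegrableOn.integrable_indicator ?_ hRm
    refine Measure.integrableOn_of_bounded (M := √(K ^ 2 + K ^ 2) ^ p) hRfin
      ((measurable_gradNorm φ).pow_const p).aestronglyMeasurable
      (Filter.Eventually.of_forall fun x ↦ ?_)
    rw [Real.norm_of_nonneg (Real.rpow_nonneg (gradNorm_nonneg φ x) p)]
    exact Real.rpow_le_rpow (gradNorm_nonneg φ x) (hφ.gradNorm_le x) hp0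
  have hdiff : ∀ᵐ s : ℝ, ∀ᵐ t : ℝ, DifferentiableAt ℝ φ (s, t) :=
    Measure.ae_ae_of_ae_prod (hφ.ae_differentiableAt (μ := volume))
  rw [← integral_indicator hRm, ← integral_indicator hRm, Measure.volume_eq_prod,
    integral_prod _ hfi, integral_prod _ hgi, ← integral_const_mul]
  refine integral_mono_ae hfi.integral_prod_left (hgi.integral_prod_left.const_mul _) ?_
  filter_upwards [hdiff] with s hs
  simp only [hslice]
  by_cases hsA : s ∈ A
  · simp only [Set.indicator_of_mem hsA]
    refine ((hvert s).setIntegral_rpow_le_of_eq_zero hp (hab s) (hε s) (hzero s)).trans ?_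
    gcongr ε ^ p * ?_
    refine integral_mono_of_nonneg (Filter.Eventually.of_forall fun _ ↦ by positivity) ?_ ?_
    · refine Measure.integrableOn_of_bounded (M := √(K ^ 2 + K ^ 2) ^ p) (by simp)
        (((measurable_gradNorm φ).comp measurable_prodMk_left).pow_const p).aestronglyMeasurable
        (Filter.Eventually.of_forall fun t ↦ ?_)
      rw [Real.norm_of_nonneg (Real.rpow_nonneg (gradNorm_nonneg φ _) p)]
      exact Real.rpow_le_rpow (gradNorm_nonneg φ _) (hφ.gradNorm_le _) hp0
    · filter_upwards [ae_restrict_of_ae hs] with t ht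
      exact Real.rpow_le_rpow (abs_nonneg _) ht.abs_deriv_slice_le_gradNorm hp0
  · simp [hsA]

/-- Rescaled Poincaré inequality: with `ε = 1/N` and the rough layer
`R^ε = {0 < x₁ < 1, ε γ(x₁/ε) < x₂ < 0}`, every Lipschitz `φ` vanishing on and
below the rough boundary satisfies
`∫_{R^ε} |φ|^p ≤ C ε^p ∫_{R^ε} ‖∇φ‖^p`, with `C = C(p, γ)`. -/
theorem rescaled_poincare_inequality (p : ℝ) (hp : 1 ≤ p) (γ : ℝ → ℝ)
    (hγc : Continuous γ) (hγper : Function.Periodic γ 1)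
    (hγval : ∀ t, γ t ∈ Set.Ioo (-1 : ℝ) 0) :
    ∃ C : ℝ, 0 < C ∧ ∀ N : ℕ, 0 < N →
      ∀ (K : NNReal) (φ : ℝ × ℝ → ℝ), LipschitzWith K φ →
      (∀ x : ℝ × ℝ, x.2 ≤ (1 / N : ℝ) * γ (x.1 / (1 / N : ℝ)) → φ x = 0) →
      (∫ x in {x : ℝ × ℝ | x.1 ∈ Set.Ioo (0:ℝ) 1 ∧
            (1 / N : ℝ) * γ (x.1 / (1 / N : ℝ)) < x.2 ∧ x.2 < 0},
          |φ x| ^ p) ≤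
        C * (1 / N : ℝ) ^ p *
          ∫ x in {x : ℝ × ℝ | x.1 ∈ Set.Ioo (0:ℝ) 1 ∧
              (1 / N : ℝ) * γ (x.1 / (1 / N : ℝ)) < x.2 ∧ x.2 < 0},
            gradNorm φ x ^ p := by
  refine ⟨1, one_pos, fun N hN K φ hφ hzero ↦ ?_⟩
  have hε : (0 : ℝ) < 1 / N := by positivity
  rw [one_mul]
  refine hφ.setIntegral_rpow_le_gradNorm hp measurableSet_Ioo (by simp)
    (a := fun s ↦ (1 / N : ℝ) * γ (s / (1 / N : ℝ))) (b := fun _ ↦ 0)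
    (by fun_prop) measurable_const (fun s ↦ ?_) (fun s ↦ ?_) fun s ↦ hzero _ le_rfl
  · exact mul_neg_of_pos_of_neg hε (hγval _).2
  · nlinarith [(hγval (s / (1 / N : ℝ))).1]
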